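/- For real s > 2 (so that s > 2t for all t ∈ [0,1]), the Laplace transform ∫₀^∞ e^{-sx} I_v(q;x) dx equals (2^{v+q-1/2} Γ(v+q) Γ(v+1))/(√π s^{v+1} Γ(2v+q+1/2)) · ₂F₁(v+1, v+q; 2v+q+1/2; 2/s), where ₂F₁ is the Gauss hypergeometric function. -/

import Mathlib

open Complex MeasureTheory intervalIntegral

/-- The extended modified Bessel function `I_v(q;x)` (integral representation (eq.7)). -/
noncomputable def extI (v q x : ℂ) : ℂ :=
  ((x/2)^v * (2:ℂ)^(2*v + q - 1/2)) / ((Real.sqrt Real.pi : ℂ) * Complex.Gamma (v + 1/2)) *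
    ∫ t in (0:ℝ)..1, (t:ℂ)^(v + q - 1) * ((1 : ℂ) - (t:ℂ))^(v - 1/2) * Complex.exp (2 * x * t)

/-- The Gauss hypergeometric function `₂F₁(a, b; c; z)` as a power series. -/
noncomputable def F21 (a b c z : ℂ) : ℂ :=
  ∑' n : ℕ, (Complex.Gamma (a + n) / Complex.Gamma a) * (Complex.Gamma (b + n) / Complex.Gamma b) /
    (Complex.Gamma (c + n) / Complex.Gamma c) * z^n / (n.factorial : ℂ)

lemma integrableOn_cpow_mul_exp_neg_mul_Ioi {w : ℂ} {r : ℝ} (hw : 0 < w.re) (hr : 0 < r) :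
    IntegrableOn (fun x : ℝ => (x : ℂ) ^ (w - 1) * Complex.exp (-(r * x))) (Set.Ioi 0) := by
  refine not_imp_comm.1 integral_undef ?_
  rw [Complex.integral_cpow_mul_exp_neg_mul_Ioi hw hr]
  exact mul_ne_zero (by simp [Complex.cpow_eq_zero_iff, hr.ne'])
    (Complex.Gamma_ne_zero_of_re_pos hw)

lemma integral_norm_cpow_mul_exp_neg_mul_Ioi {w : ℂ} {r : ℝ} (hw : 0 < w.re) (hr : 0 < r) :
    ∫ x in Set.Ioi (0 : ℝ), ‖(x : ℂ) ^ (w - 1) * Complex.exp (-(r * x))‖ =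
      (1 / r) ^ w.re * Real.Gamma w.re := by
  rw [← Real.integral_rpow_mul_exp_neg_mul_Ioi hw hr]
  refine setIntegral_congr_fun measurableSet_Ioi fun x hx => ?_
  simp [Complex.norm_cpow_eq_rpow_re_of_pos (Set.mem_Ioi.1 hx), Complex.norm_exp]

lemma summable_pow_div_factorial_mul_Gamma {ρ r z : ℝ} (hρ : 0 < ρ) (hz : 0 < z) (hzr : z < r) :
    Summable fun n : ℕ => z ^ n / n.factorial * ((1 / r) ^ (ρ + n) * Real.Gamma (ρ + n)) := by
  have hr : 0 < r := hz.trans hzr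
  have hpos : ∀ n : ℕ,
      0 < z ^ n / n.factorial * ((1 / r) ^ (ρ + n) * Real.Gamma (ρ + n)) := fun n => by
    have := Real.Gamma_pos_of_pos (show 0 < ρ + n by positivity)
    positivity
  refine summable_of_ratio_test_tendsto_lt_one (l := z / r) ((div_lt_one hr).2 hzr)
    (Filter.Eventually.of_forall fun n => (hpos n).ne') ?_
  have h_lim : Filter.Tendsto (fun n : ℕ => z / r * (((n : ℝ) + ρ) / (n + 1))) Filter.atTop
      (nhds (z / r)) := by
    have h := tendsto_add_mul_div_add_mul_atTop_nhds ρ (1 : ℝ) 1 (one_ne_zero (α := ℝ))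
    have h' := h.const_mul (z / r)
    simp only [one_mul, div_one, mul_one] at h'
    simpa only [add_comm] using h'
  refine h_lim.congr fun n => ?_
  rw [Real.norm_of_nonneg (hpos _).le, Real.norm_of_nonneg (hpos _).le]
  have hn : 0 < ρ + n := by positivity
  have hG := (Real.Gamma_pos_of_pos hn).ne'
  have hrp : (1 / r) ^ (ρ + n) ≠ 0 := (Real.rpow_pos_of_pos (by positivity) _).ne'
  push_cast [Nat.factorial_succ]
  rw [← add_assoc, Real.Gamma_add_one hn.ne', Real.rpow_add_one (by positivity), pow_succ]
  have hf : (n.factorial : ℝ) ≠ 0 := by positivity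
  have hzn : z ^ n ≠ 0 := by positivity
  field_simp
  ring

/-- Termwise Laplace transform of an exponential-type power series with bounded coefficients. -/
lemma hasSum_laplace_powerSeries {w : ℂ} {r z : ℝ} (hw : 0 < w.re) (hz : 0 < z) (hzr : z < r)
    {β : ℕ → ℂ} {M : ℝ} (hβ : ∀ n, ‖β n‖ ≤ M) :
    HasSum (fun n : ℕ => (z : ℂ) ^ n / n.factorial * β n *
        ((1 / r : ℂ) ^ (w + n) * Complex.Gamma (w + n)))
      (∫ x in Set.Ioi (0 : ℝ), ∑' n : ℕ, (z : ℂ) ^ n / n.factorial * β n *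
        ((x : ℂ) ^ (w + n - 1) * Complex.exp (-(r * x)))) := by
  have hr : 0 < r := hz.trans hzr
  have hwn : ∀ n : ℕ, 0 < (w + n).re := fun n => by
    simp only [Complex.add_re, Complex.natCast_re]; positivity
  have h := hasSum_integral_of_summable_integral_norm (μ := volume.restrict (Set.Ioi (0 : ℝ)))
    (F := fun (n : ℕ) (x : ℝ) => (z : ℂ) ^ n / n.factorial * β n *
        ((x : ℂ) ^ (w + n - 1) * Complex.exp (-(r * x))))
    (fun n => (integrableOn_cpow_mul_exp_neg_mul_Ioi (hwn n) hr).const_mul _) ?_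
  · simpa only [MeasureTheory.integral_const_mul, Complex.integral_cpow_mul_exp_neg_mul_Ioi (hwn _) hr] using h
  · have h_norm : ∀ n : ℕ, ∫ x in Set.Ioi (0 : ℝ), ‖(z : ℂ) ^ n / n.factorial * β n *
        ((x : ℂ) ^ (w + n - 1) * Complex.exp (-(r * x)))‖ =
        z ^ n / n.factorial * ‖β n‖ * ((1 / r) ^ (w.re + n) * Real.Gamma (w.re + n)) := by
      intro n
      simp_rw [norm_mul ((z : ℂ) ^ n / n.factorial * β n)]
      rw [MeasureTheory.integral_const_mul, integral_norm_cpow_mul_exp_neg_mul_Ioi (hwn n) hr]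
      simp [abs_of_pos hz]
    simp_rw [h_norm]
    refine .of_nonneg_of_le (fun n => ?_) (fun n => ?_)
      ((summable_pow_div_factorial_mul_Gamma hw hz hzr).mul_left M)
    · have := Real.Gamma_pos_of_pos (show 0 < w.re + n by positivity)
      positivity
    · have := Real.Gamma_pos_of_pos (show 0 < w.re + n by positivity)
      calc _ = ‖β n‖ * (z ^ n / n.factorial *
            ((1 / r) ^ (w.re + n) * Real.Gamma (w.re + n))) := by ring
        _ ≤ _ := by gcongr; exact hβ n

lemma cpow_add_natCast_sub_one {t : ℝ} (ht : 0 < t) (a : ℂ) (n : ℕ) :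
    (t : ℂ) ^ (a + n - 1) = (t : ℂ) ^ (a - 1) * (t : ℂ) ^ n := by
  rw [show a + n - 1 = (a - 1) + n by ring,
    Complex.cpow_add _ _ (by exact_mod_cast ht.ne'), Complex.cpow_natCast]

lemma norm_betaIntegral_add_natCast_le {a b : ℂ} (ha : 0 < a.re) (hb : 0 < b.re) (n : ℕ) :
    ‖Complex.betaIntegral (a + n) b‖ ≤
      ∫ t in (0 : ℝ)..1, ‖(t : ℂ) ^ (a - 1) * (1 - (t : ℂ)) ^ (b - 1)‖ := by
  refine intervalIntegral.norm_integral_le_of_norm_le zero_le_one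
    (Filter.Eventually.of_forall fun t ht => ?_) (Complex.betaIntegral_convergent ha hb).norm
  rw [cpow_add_natCast_sub_one ht.1, mul_right_comm, norm_mul]
  refine mul_le_of_le_one_right (norm_nonneg _) ?_
  rw [norm_pow, Complex.norm_real, Real.norm_of_nonneg ht.1.le]
  exact pow_le_one₀ ht.1.le ht.2

/-- Power series expansion of the Euler integral representing Kummer's function. -/
lemma hasSum_betaIntegral_mul_pow {a b : ℂ} (ha : 0 < a.re) (hb : 0 < b.re) (y : ℂ) :
    HasSum (fun n : ℕ => y ^ n / n.factorial * Complex.betaIntegral (a + n) b)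
      (∫ t in (0 : ℝ)..1,
        (t : ℂ) ^ (a - 1) * (1 - (t : ℂ)) ^ (b - 1) * Complex.exp (y * t)) := by
  have h_int := Complex.betaIntegral_convergent ha hb
  have h_exp : ∀ u : ℂ, HasSum (fun n : ℕ => u ^ n / n.factorial) (Complex.exp u) := fun u => by
    rw [Complex.exp_eq_exp_ℂ]; exact NormedSpace.expSeries_div_hasSum_exp u
  have h_sum : Summable fun n : ℕ => ‖y‖ ^ n / n.factorial := Real.summable_pow_div_factorial _
  have h := intervalIntegral.hasSum_integral_of_dominated_convergence (μ := volume)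
    (a := 0) (b := 1)
    (F := fun (n : ℕ) (t : ℝ) =>
      (t : ℂ) ^ (a - 1) * (1 - (t : ℂ)) ^ (b - 1) * ((y * t) ^ n / n.factorial))
    (f := fun t : ℝ => (t : ℂ) ^ (a - 1) * (1 - (t : ℂ)) ^ (b - 1) * Complex.exp (y * t))
    (fun n t => ‖(t : ℂ) ^ (a - 1) * (1 - (t : ℂ)) ^ (b - 1)‖ * (‖y‖ ^ n / n.factorial))
    (fun n => ?_) (fun n => ?_) ?_ ?_ ?_
  · refine (congrArg (HasSum · _) (funext fun n => ?_)).mpr h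
    rw [Complex.betaIntegral, ← intervalIntegral.integral_const_mul]
    refine intervalIntegral.integral_congr_ae (Filter.Eventually.of_forall fun t ht => ?_)
    rw [Set.uIoc_of_le zero_le_one] at ht
    rw [cpow_add_natCast_sub_one ht.1, mul_pow]
    ring
  · have h_meas := h_int.aestronglyMeasurable
    rw [Set.uIoc_of_le zero_le_one]
    exact h_meas.mul (by fun_prop)
  · refine Filter.Eventually.of_forall fun t ht => ?_
    rw [Set.uIoc_of_le zero_le_one] at ht
    rw [norm_mul]
    gcongr
    rw [norm_div, norm_pow, norm_mul, Complex.norm_real, Real.norm_of_nonneg ht.1.le,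
      Complex.norm_natCast]
    have := mul_le_of_le_one_right (norm_nonneg y) ht.2
    have := mul_nonneg (norm_nonneg y) ht.1.le
    gcongr
  · exact Filter.Eventually.of_forall fun t _ => h_sum.mul_left _
  · simp_rw [tsum_mul_left]
    exact h_int.norm.mul_const _
  · exact Filter.Eventually.of_forall fun t _ => (h_exp _).mul_left _

lemma betaIntegral_eq_Gamma_mul_div {a b : ℂ} (ha : 0 < a.re) (hb : 0 < b.re) :
    Complex.betaIntegral a b = Complex.Gamma a * Complex.Gamma b / Complex.Gamma (a + b) := by
  rw [Complex.Gamma_mul_Gamma_eq_betaIntegral ha hb, mul_div_cancel_left₀]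
  exact Complex.Gamma_ne_zero_of_re_pos (by simp only [Complex.add_re]; positivity)

theorem extI_laplace_transform (v q : ℂ) (hvq : 0 < (v + q).re) (hv : (-1/2 : ℝ) < v.re)
    (s : ℝ) (hs : 2 < s) :
    ∫ x in Set.Ioi (0:ℝ), Complex.exp (-(s:ℂ) * x) * extI v q (x:ℂ) =
      ((2:ℂ)^(v + q - 1/2) * Complex.Gamma (v + q) * Complex.Gamma (v + 1)) /
        ((Real.sqrt Real.pi : ℂ) * (s:ℂ)^(v + 1) * Complex.Gamma (2*v + q + 1/2)) *
      F21 (v + 1) (v + q) (2*v + q + 1/2) (2 / (s:ℂ)) := by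
  have hs0 : 0 < s := two_pos.trans hs
  have hsC : (s : ℂ) ≠ 0 := by exact_mod_cast hs0.ne'
  have hb : 0 < (v + 1 / 2).re := by norm_num [Complex.add_re]; linarith
  have hw : 0 < (v + 1).re := by simp only [Complex.add_re, Complex.one_re]; linarith
  have hc : (2 * v + q + 1 / 2) = (v + q) + (v + 1 / 2) := by ring
  have hGb := Complex.Gamma_ne_zero_of_re_pos hb
  have hGa := Complex.Gamma_ne_zero_of_re_pos hvq
  have hGw := Complex.Gamma_ne_zero_of_re_pos hw
  have hGc : Complex.Gamma (2 * v + q + 1 / 2) ≠ 0 := by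
    rw [hc]
    exact Complex.Gamma_ne_zero_of_re_pos (by rw [Complex.add_re]; positivity)
  have hpi : (Real.sqrt Real.pi : ℂ) ≠ 0 := by
    exact_mod_cast (Real.sqrt_pos.2 Real.pi_pos).ne'
  have hsv : (s : ℂ) ^ (v + 1) ≠ 0 := by simp [Complex.cpow_eq_zero_iff, hsC]
  set C : ℂ := (2 : ℂ) ^ (v + q - 1 / 2) /
    ((Real.sqrt Real.pi : ℂ) * Complex.Gamma (v + 1 / 2)) with hC
  have h_integrand : ∀ x ∈ Set.Ioi (0 : ℝ), Complex.exp (-(s : ℂ) * x) * extI v q x =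
      C * ∑' n : ℕ, ((2 : ℝ) : ℂ) ^ n / n.factorial * Complex.betaIntegral (v + q + n) (v + 1 / 2) *
        ((x : ℂ) ^ (v + 1 + n - 1) * Complex.exp (-(s * x))) := by
    intro x hx
    have h_two : ((x : ℂ) / 2) ^ v * (2 : ℂ) ^ (2 * v + q - 1 / 2) =
        (2 : ℂ) ^ (v + q - 1 / 2) * (x : ℂ) ^ v := by
      have h := Complex.mul_cpow_ofReal_nonneg (div_nonneg (Set.mem_Ioi.1 hx).le zero_le_two)
        (zero_le_two (α := ℝ)) v
      rw [← Complex.ofReal_mul, div_mul_cancel₀ _ (two_ne_zero' ℝ)] at h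
      rw [h, show 2 * v + q - 1 / 2 = v + (v + q - 1 / 2) by ring,
        Complex.cpow_add _ _ two_ne_zero]
      push_cast
      ring
    have h_euler := (hasSum_betaIntegral_mul_pow hvq hb (2 * x)).tsum_eq
    rw [show v + 1 / 2 - 1 = v - 1 / 2 by ring] at h_euler
    rw [extI, ← h_euler, h_two, hC, ← tsum_mul_left, ← tsum_mul_left, ← tsum_mul_left]
    refine tsum_congr fun n => ?_
    rw [cpow_add_natCast_sub_one hx, add_sub_cancel_right, mul_pow, neg_mul]
    push_cast
    ring
  rw [setIntegral_congr_fun measurableSet_Ioi h_integrand, MeasureTheory.integral_const_mul,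
    ← (hasSum_laplace_powerSeries hw two_pos hs
      (norm_betaIntegral_add_natCast_le hvq hb)).tsum_eq, F21, ← tsum_mul_left, ← tsum_mul_left]
  refine tsum_congr fun n => ?_
  have hvqn : 0 < (v + q + n).re := by
    rw [Complex.add_re, Complex.natCast_re]; positivity
  have hGcn : Complex.Gamma (2 * v + q + 1 / 2 + n) ≠ 0 := by
    rw [hc, add_right_comm]
    exact Complex.Gamma_ne_zero_of_re_pos (by rw [Complex.add_re]; positivity)
  have h_pow : (1 / s : ℂ) ^ (v + 1 + n) = 1 / ((s : ℂ) ^ (v + 1) * (s : ℂ) ^ n) := by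
    rw [one_div, Complex.inv_cpow _ _ (by
        rw [Complex.arg_ofReal_of_nonneg hs0.le]; exact Real.pi_pos.ne),
      Complex.cpow_add _ _ hsC, Complex.cpow_natCast, one_div]
  rw [betaIntegral_eq_Gamma_mul_div hvqn hb, h_pow,
    show v + q + n + (v + 1 / 2) = 2 * v + q + 1 / 2 + n by ring, hC, div_pow]
  have hf : (n.factorial : ℂ) ≠ 0 := by exact_mod_cast n.factorial_ne_zero
  have hsn : (s : ℂ) ^ n ≠ 0 := pow_ne_zero _ hsC
  push_cast
  generalize Complex.Gamma (v + 1 / 2) = G₁ at *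
  generalize Complex.Gamma (2 * v + q + 1 / 2) = G₂ at *
  generalize Complex.Gamma (2 * v + q + 1 / 2 + n) = G₃ at *
  generalize (2 : ℂ) ^ (v + q - 1 / 2) = P at *
  generalize (s : ℂ) ^ (v + 1) = S at *
  field_simp
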